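/- For every T ≥ 1 and every θ* ∈ ℝⁿ, the cumulative Bellman-error regret of OS-GPTD obeys the exact telescoped identity Σ_{t=1}^T [l_t(θ̂_{t-1}) − l_t(θ*)] = Σ_{t=1}^T (1/(4σ_n²)) ∇_tᵀ J_t⁻¹ ∇_t + σ_n² θ*ᵀ J_0 θ* − σ_n² (θ* − θ̂_T)ᵀ J_T (θ* − θ̂_T), where l_t(θ) = (r_t − h_tᵀ θ)², ∇_t = 2 h_t (h_tᵀ θ̂_{t-1} − r_t), and J_t = Σ_t⁻¹ with J_0 = σ_θ⁻² I_n. -/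

import Mathlib

open Matrix Finset

/-- The Sherman–Morrison formula for a symmetric rank-one perturbation, read from right to left. -/
lemma inv_sub_smul_vecMulVec {ι : Type*} [Fintype ι] [DecidableEq ι] {S : Matrix ι ι ℝ}
    (hS : IsUnit S) {h : ι → ℝ} {s : ℝ} (hs : s ≠ 0) (hD : h ⬝ᵥ S *ᵥ h + s ≠ 0) :
    (S - (h ⬝ᵥ S *ᵥ h + s)⁻¹ • vecMulVec (S *ᵥ h) (h ᵥ* S))⁻¹ =
      S⁻¹ + s⁻¹ • vecMulVec h h := by
  have hdet := (isUnit_iff_isUnit_det S).1 hS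
  have hcoef : s⁻¹ - (h ⬝ᵥ S *ᵥ h + s)⁻¹ -
      (h ⬝ᵥ S *ᵥ h + s)⁻¹ * s⁻¹ * (h ⬝ᵥ S *ᵥ h) = 0 := by
    field_simp
    ring
  apply inv_eq_right_inv
  rw [Matrix.sub_mul, Matrix.mul_add, Matrix.mul_add, mul_nonsing_inv _ hdet, Matrix.mul_smul,
    mul_vecMulVec, Matrix.smul_mul, vecMulVec_mul, vecMul_vecMul, mul_nonsing_inv _ hdet,
    vecMul_one, Matrix.mul_smul, Matrix.smul_mul, vecMulVec_mul_vecMulVec, ← dotProduct_mulVec]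
  ext i j
  simp only [Matrix.sub_apply, Matrix.add_apply, Matrix.smul_apply, vecMulVec_apply,
    smul_eq_mul, Pi.smul_apply]
  linear_combination (S *ᵥ h) i * h j * hcoef

/-- A rank-one Kalman downdate preserves positive definiteness. -/
lemma posDef_sub_smul_vecMulVec {ι : Type*} [Fintype ι] [DecidableEq ι] {S : Matrix ι ι ℝ}
    (hS : S.PosDef) (h : ι → ℝ) {s : ℝ} (hs : 0 < s) :
    (S - (h ⬝ᵥ S *ᵥ h + s)⁻¹ • vecMulVec (S *ᵥ h) (h ᵥ* S)).PosDef := by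
  have hq : 0 ≤ h ⬝ᵥ S *ᵥ h := by simpa using hS.posSemidef.dotProduct_mulVec_nonneg h
  have hinv := inv_sub_smul_vecMulVec hS.isUnit hs.ne' (by positivity : h ⬝ᵥ S *ᵥ h + s ≠ 0)
  rw [← Matrix.posDef_inv_iff, hinv]
  refine hS.inv.add_posSemidef (PosSemidef.smul ?_ (inv_nonneg.2 hs.le))
  simpa using posSemidef_vecMulVec_self_star h

/-- One step of the recursion: the regret equals the gradient term plus the decrease of the
quadratic potential. -/
lemma kalman_step_regret {ι : Type*} [Fintype ι] [DecidableEq ι] {S : Matrix ι ι ℝ}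
    (hS : S.PosDef) (h : ι → ℝ) {s : ℝ} (hs : 0 < s) (r : ℝ) (θ θs θ' : ι → ℝ)
    {S' : Matrix ι ι ℝ}
    (hθ' : θ' = θ + ((r - h ⬝ᵥ θ) / (h ⬝ᵥ S *ᵥ h + s)) • (S *ᵥ h))
    (hS' : S' = S - (h ⬝ᵥ S *ᵥ h + s)⁻¹ • vecMulVec (S *ᵥ h) (h ᵥ* S)) :
    (r - h ⬝ᵥ θ) ^ 2 - (r - h ⬝ᵥ θs) ^ 2 =
      1 / (4 * s) * (((2 * (h ⬝ᵥ θ - r)) • h) ⬝ᵥ S' *ᵥ ((2 * (h ⬝ᵥ θ - r)) • h)) +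
        s * ((θs - θ) ⬝ᵥ S⁻¹ *ᵥ (θs - θ)) - s * ((θs - θ') ⬝ᵥ S'⁻¹ *ᵥ (θs - θ')) := by
  have hq : 0 ≤ h ⬝ᵥ S *ᵥ h := by simpa using hS.posSemidef.dotProduct_mulVec_nonneg h
  have hD : h ⬝ᵥ S *ᵥ h + s ≠ 0 := by positivity
  have hinv : S'⁻¹ = S⁻¹ + s⁻¹ • vecMulVec h h := by
    rw [hS', inv_sub_smul_vecMulVec hS.isUnit hs.ne' hD]
  have hdet := (isUnit_iff_isUnit_det S).1 hS.isUnit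
  have hsymm : Sᵀ = S := by simpa using hS.isHermitian.eq
  have hvec : h ᵥ* S = S *ᵥ h := by rw [← mulVec_transpose, hsymm]
  have hJS : S⁻¹ *ᵥ S *ᵥ h = h := by rw [mulVec_mulVec, nonsing_inv_mul _ hdet, one_mulVec]
  have hSJ (v : ι → ℝ) : (S *ᵥ h) ⬝ᵥ S⁻¹ *ᵥ v = h ⬝ᵥ v := by
    rw [← hvec, ← dotProduct_mulVec, mulVec_mulVec, mul_nonsing_inv _ hdet, one_mulVec]
  have hgrad : h ⬝ᵥ S' *ᵥ h =
      h ⬝ᵥ S *ᵥ h - (h ⬝ᵥ S *ᵥ h + s)⁻¹ * (h ⬝ᵥ S *ᵥ h) ^ 2 := by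
    rw [hS', hvec, sub_mulVec, smul_mulVec, vecMulVec_mulVec, dotProduct_sub, dotProduct_smul,
      op_smul_eq_smul, dotProduct_smul, dotProduct_comm (S *ᵥ h) h, smul_eq_mul, smul_eq_mul]
    ring
  have hv : θs - θ' =
      (θs - θ) - ((r - h ⬝ᵥ θ) / (h ⬝ᵥ S *ᵥ h + s)) • (S *ᵥ h) := by
    rw [hθ', sub_sub]
  have ha : h ⬝ᵥ θs = h ⬝ᵥ (θs - θ) + h ⬝ᵥ θ := by rw [dotProduct_sub]; ring
  rw [hv, hinv, ha]
  generalize θs - θ = v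
  simp only [add_mulVec, smul_mulVec, vecMulVec_mulVec, op_smul_eq_smul, mulVec_sub, mulVec_smul,
    dotProduct_add, dotProduct_sub, sub_dotProduct, dotProduct_smul, smul_dotProduct, hJS, hSJ,
    smul_eq_mul, hgrad, dotProduct_comm v h, dotProduct_comm (S *ᵥ h) h]
  field_simp
  ring

/-- Exact telescoped identity for the cumulative Bellman-error regret:
`∑_{t=1}^T [l_t(θ̂_{t-1}) − l_t(θ*)]
  = ∑_{t=1}^T (1/(4σ_n²)) ∇_tᵀ J_t⁻¹ ∇_t + σ_n² θ*ᵀ J_0 θ*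
    − σ_n² (θ* − θ̂_T)ᵀ J_T (θ* − θ̂_T)`, with `J_t = Σ_t⁻¹`. -/
theorem osgptd_regret_telescoped_identity
    (n : ℕ) (hn : 1 ≤ n) (σθ σn : ℝ) (hσθ : 0 < σθ) (hσn : 0 < σn)
    (h : ℕ → Fin n → ℝ) (r : ℕ → ℝ)
    (θ : ℕ → Fin n → ℝ) (S : ℕ → Matrix (Fin n) (Fin n) ℝ)
    (hθ0 : θ 0 = 0)
    (hS0 : S 0 = σθ ^ 2 • (1 : Matrix (Fin n) (Fin n) ℝ))
    (hθrec : ∀ t : ℕ, θ (t + 1) = θ t +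
      ((r (t + 1) - h (t + 1) ⬝ᵥ θ t) / (h (t + 1) ⬝ᵥ S t *ᵥ h (t + 1) + σn ^ 2)) •
        (S t *ᵥ h (t + 1)))
    (hSrec : ∀ t : ℕ, S (t + 1) = S t -
      (h (t + 1) ⬝ᵥ S t *ᵥ h (t + 1) + σn ^ 2)⁻¹ •
        vecMulVec (S t *ᵥ h (t + 1)) (h (t + 1) ᵥ* S t))
    (hSinv : ∀ t : ℕ, IsUnit (S t)) :
    ∀ T : ℕ, 1 ≤ T → ∀ θs : Fin n → ℝ,
      ∑ t ∈ Finset.Icc 1 T, ((r t - h t ⬝ᵥ θ (t - 1)) ^ 2 - (r t - h t ⬝ᵥ θs) ^ 2) =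
        ∑ t ∈ Finset.Icc 1 T, (1 / (4 * σn ^ 2)) *
            (((2 * (h t ⬝ᵥ θ (t - 1) - r t)) • h t) ⬝ᵥ
              ((S t)⁻¹)⁻¹ *ᵥ ((2 * (h t ⬝ᵥ θ (t - 1) - r t)) • h t))
        + σn ^ 2 * (θs ⬝ᵥ (S 0)⁻¹ *ᵥ θs)
        - σn ^ 2 * ((θs - θ T) ⬝ᵥ (S T)⁻¹ *ᵥ (θs - θ T)) := by
  have hs : 0 < σn ^ 2 := by positivity
  have hpos (t : ℕ) : (S t).PosDef := by
    induction t with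
    | zero => rw [hS0]; exact PosDef.one.smul (by positivity)
    | succ t ih => rw [hSrec]; exact posDef_sub_smul_vecMulVec ih _ hs
  rintro T - θs
  induction T with
  | zero => simp [hθ0]
  | succ T ih =>
    have hstep := kalman_step_regret (hpos T) (h (T + 1)) hs (r (T + 1)) (θ T) θs _
      (hθrec T) (hSrec T)
    have hinv : ((S (T + 1))⁻¹)⁻¹ = S (T + 1) :=
      nonsing_inv_nonsing_inv _ ((isUnit_iff_isUnit_det _).1 (hSinv (T + 1)))
    rw [Finset.sum_Icc_succ_top (by omega), Finset.sum_Icc_succ_top (by omega), ih,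
      Nat.add_sub_cancel, hinv, hstep]
    ring
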